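/- arXiv:1802.02176 — 5 statements merged into one kernel-verified Lean document; each statement's English description precedes it below -/
import Mathlib

section
/- Let σ ⊆ ℝⁿ be a closed, full-dimensional convex cone with σ ≠ ℝⁿ, and suppose that its lineality space lin σ = σ ∩ (−σ) is a rational subspace with respect to the standard basis (i.e., lin σ is spanned by vectors all of whose coordinates are rational). Then there exists a nonzero linear functional H : ℝⁿ → ℝ with all coefficients rational in the standard basis such that H(x) ≥ 0 for every x ∈ σ. -/
open Pointwise

/-- A convex cone: a subset containing 0, closed under addition and
multiplication by nonnegative real scalars. -/
def IsConvexCone {V : Type*} [AddCommGroup V] [Module ℝ V] (σ : Set V) : Prop :=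
  (0 : V) ∈ σ ∧ (∀ x ∈ σ, ∀ y ∈ σ, x + y ∈ σ) ∧ ∀ c : ℝ, 0 ≤ c → ∀ x ∈ σ, c • x ∈ σ

/-- A point outside a closed convex cone is separated from it by a linear functional that is
nonnegative on the cone. -/
theorem IsConvexCone.exists_dual_neg {n : ℕ} {σ : Set (Fin n → ℝ)} (hcone : IsConvexCone σ)
    (hclosed : IsClosed σ) {x : Fin n → ℝ} (hx : x ∉ σ) :
    ∃ f : Module.Dual ℝ (Fin n → ℝ), (∀ a ∈ σ, 0 ≤ f a) ∧ f x < 0 := by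
  obtain ⟨h0, hadd, hsmul⟩ := hcone
  have hconv : Convex ℝ σ := fun a ha b hb s t hs ht _ =>
    hadd _ (hsmul s hs a ha) _ (hsmul t ht b hb)
  obtain ⟨f, u, hu, hux⟩ := geometric_hahn_banach_closed_point hconv hclosed hx
  have hu0 : 0 < u := by simpa using hu 0 h0
  refine ⟨-(f : (Fin n → ℝ) →ₗ[ℝ] ℝ), fun a ha => ?_, ?_⟩
  · by_contra hlt
    have hfa : 0 < f a := by simpa using hlt
    have h := hu _ (hsmul (u / f a) (by positivity) a ha)
    rw [map_smul, smul_eq_mul, div_mul_cancel₀ _ hfa.ne'] at h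
    exact h.false
  · simpa using hu0.trans hux

/-- The linear functionals on `ℝⁿ` with rational coefficients. -/
def rationalDual (n : ℕ) : AddSubgroup (Module.Dual ℝ (Fin n → ℝ)) where
  carrier := {f | ∀ i, ∃ q : ℚ, f (Pi.single i 1) = (q : ℝ)}
  zero_mem' := fun _ => ⟨0, by simp⟩
  add_mem' := fun {f g} hf hg i => by
    obtain ⟨p, hp⟩ := hf i
    obtain ⟨q, hq⟩ := hg i
    exact ⟨p + q, by simp [hp, hq]⟩
  neg_mem' := fun {f} hf i => by
    obtain ⟨p, hp⟩ := hf i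
    exact ⟨-p, by simp [hp]⟩

theorem smul_mem_rationalDual {n : ℕ} {f : Module.Dual ℝ (Fin n → ℝ)} (hf : f ∈ rationalDual n)
    (r : ℚ) : (r : ℝ) • f ∈ rationalDual n := fun i => by
  obtain ⟨p, hp⟩ := hf i
  exact ⟨r * p, by simp [hp]⟩

/-- A functional vanishing on a set of rational vectors is a real linear combination of rational
functionals vanishing on that set. -/
theorem mem_span_rationalDual {n : ℕ} {s : Set (Fin n → ℝ)}
    (hs : ∀ v ∈ s, ∀ i : Fin n, ∃ q : ℚ, v i = (q : ℝ))
    {h : Module.Dual ℝ (Fin n → ℝ)} (hh : ∀ v ∈ s, h v = 0) :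
    h ∈ Submodule.span ℝ {f | f ∈ rationalDual n ∧ ∀ v ∈ s, f v = 0} := by
  classical
  let β := Module.Basis.ofVectorSpace ℚ ℝ
  let c : Fin n → _ →₀ ℚ := fun i => β.repr (h (Pi.single i 1))
  let F := Finset.univ.biUnion fun i => (c i).support
  have hdecomp : h = ∑ j ∈ F, β j • Fintype.linearCombination ℝ (fun i => ((c i j : ℚ) : ℝ)) := by
    refine LinearMap.pi_ext' fun i => LinearMap.ext_ring ?_
    have h1 : h (Pi.single i 1) = ∑ j ∈ F, c i j • β j := by
      rw [← β.linearCombination_repr (h (Pi.single i 1)), Finsupp.linearCombination_apply]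
      refine Finsupp.sum_of_support_subset _ ?_ _ (by simp)
      exact Finset.subset_biUnion_of_mem (fun i => (c i).support) (Finset.mem_univ i)
    simp only [LinearMap.comp_apply, LinearMap.single_apply, LinearMap.sum_apply,
      LinearMap.smul_apply, Fintype.linearCombination_apply_single, h1]
    exact Finset.sum_congr rfl fun j _ => by simp [Rat.smul_def, mul_comm]
  rw [hdecomp]
  refine Submodule.sum_mem _ fun j _ => Submodule.smul_mem _ _ (Submodule.subset_span ⟨?_, ?_⟩)
  · exact fun i => ⟨c i j, by simp⟩
  · intro v hv
    choose r hr using hs v hv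
    have h1 : ∑ i, r i • h (Pi.single i 1) = 0 := by
      rw [← hh v hv]
      conv_rhs => rw [LinearMap.pi_apply_eq_sum_univ h v]
      refine Finset.sum_congr rfl fun i _ => ?_
      rw [Rat.smul_def, hr, smul_eq_mul]
      congr 2
      ext k
      simp [Pi.single_apply, eq_comm]
    have h2 := congrArg (fun y => β.repr y j) h1
    simp only [map_sum, map_smul, Finsupp.coe_finsetSum, Finset.sum_apply, Finsupp.smul_apply,
      map_zero, Finsupp.zero_apply, smul_eq_mul] at h2
    rw [Fintype.linearCombination_apply]
    simp only [hr, smul_eq_mul]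
    exact_mod_cast h2

/-- If a subspace of the dual is spanned by rational functionals, then their coordinate vectors in
any finite basis of the subspace are dense. -/
theorem dense_coord_rationalDual {n : ℕ} {ι : Type*} [Fintype ι]
    {W : Submodule ℝ (Module.Dual ℝ (Fin n → ℝ))} (B : Module.Basis ι ℝ W)
    (hW : W ≤ Submodule.span ℝ {f | f ∈ rationalDual n ∧ f ∈ W}) :
    Dense {c : ι → ℝ | (B.equivFun.symm c : Module.Dual ℝ (Fin n → ℝ)) ∈ rationalDual n} := by
  let R : AddSubgroup (ι → ℝ) :=
    (rationalDual n).comap (W.subtype ∘ₗ B.equivFun.symm.toLinearMap).toAddMonoidHom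
  have key : ∀ f ∈ Submodule.span ℝ {f | f ∈ rationalDual n ∧ f ∈ W}, ∀ hf : f ∈ W,
      B.equivFun ⟨f, hf⟩ ∈ R.topologicalClosure := by
    intro f hf
    induction hf using Submodule.closure_induction with
    | zero =>
      intro hf
      have : (⟨0, hf⟩ : W) = 0 := rfl
      rw [this, map_zero]
      exact zero_mem _
    | add x y hx hy ihx ihy =>
      intro hf
      have hle : Submodule.span ℝ {f | f ∈ rationalDual n ∧ f ∈ W} ≤ W :=
        Submodule.span_le.2 fun _ h => h.2
      have : (⟨x + y, hf⟩ : W) = ⟨x, hle hx⟩ + ⟨y, hle hy⟩ := rfl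
      rw [this, map_add]
      exact add_mem (ihx _) (ihy _)
    | smul_mem t q hq =>
      intro hf
      have : (⟨t • q, hf⟩ : W) = t • ⟨q, hq.2⟩ := rfl
      rw [this, map_smul]
      have hcont : Continuous fun t : ℝ => t • B.equivFun ⟨q, hq.2⟩ := by fun_prop
      have hmem : t ∈ closure (Set.range ((↑) : ℚ → ℝ)) := Rat.denseRange_cast t
      refine map_mem_closure (f := fun t : ℝ => t • B.equivFun ⟨q, hq.2⟩) hcont hmem ?_
      rintro _ ⟨r, rfl⟩
      change (B.equivFun.symm ((r : ℝ) • B.equivFun ⟨q, hq.2⟩) : Module.Dual ℝ (Fin n → ℝ)) ∈ rationalDual n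
      rw [← map_smul, LinearEquiv.symm_apply_apply]
      exact smul_mem_rationalDual hq.1 r
  intro c
  have h := key _ (hW (B.equivFun.symm c).2) (B.equivFun.symm c).2
  rw [Subtype.coe_eta, LinearEquiv.apply_symm_apply] at h
  exact h

/-- A closed full-dimensional proper convex cone in ℝⁿ whose lineality space is a
rational subspace w.r.t. the standard basis admits a nonzero supporting linear
functional with rational coefficients. -/
theorem stmt2 {n : ℕ} (σ : Set (Fin n → ℝ)) (hcone : IsConvexCone σ)
    (hclosed : IsClosed σ) (hfull : Submodule.span ℝ σ = ⊤) (hne : σ ≠ Set.univ)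
    (hrat : ∃ s : Set (Fin n → ℝ), (∀ v ∈ s, ∀ i : Fin n, ∃ q : ℚ, v i = (q : ℝ)) ∧
      (Submodule.span ℝ s : Set (Fin n → ℝ)) = σ ∩ (-σ)) :
    ∃ H : (Fin n → ℝ) →ₗ[ℝ] ℝ, H ≠ 0 ∧ (∀ i : Fin n, ∃ q : ℚ, H (Pi.single i 1) = (q : ℝ)) ∧
      ∀ x ∈ σ, 0 ≤ H x := by
  obtain ⟨s, hs, hlin⟩ := hrat
  let D : Set (Module.Dual ℝ (Fin n → ℝ)) := {f | ∀ x ∈ σ, 0 ≤ f x}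
  have hbidual : ∀ x, (∀ f ∈ D, 0 ≤ f x) → x ∈ σ := fun x hx => by
    by_contra hxσ
    obtain ⟨f, hf, hfx⟩ := hcone.exists_dual_neg hclosed hxσ
    exact absurd (hx f hf) (not_le.2 hfx)
  have hvanish : ∀ f ∈ Submodule.span ℝ D, ∀ v ∈ s, f v = 0 := by
    intro f hf v hv
    have hv' : v ∈ σ ∩ -σ := hlin ▸ Submodule.subset_span hv
    induction hf using Submodule.span_induction with
    | mem f hf =>
      have h1 := hf v hv'.1
      have h2 := hf (-v) hv'.2
      rw [map_neg] at h2
      linarith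
    | zero => simp
    | add f g _ _ hf hg => simp [hf, hg]
    | smul t f _ hf => simp [hf]
  have hmem : ∀ f : Module.Dual ℝ (Fin n → ℝ), (∀ v ∈ s, f v = 0) → f ∈ Submodule.span ℝ D := by
    intro f hf
    rw [← Subspace.dualCoannihilator_dualAnnihilator_eq (W := Submodule.span ℝ D),
      Submodule.mem_dualAnnihilator]
    intro x hx
    rw [Submodule.mem_dualCoannihilator] at hx
    have hxD : ∀ g ∈ D, g x = 0 := fun g hg => hx g (Submodule.subset_span hg)
    have hxs : x ∈ Submodule.span ℝ s := by
      rw [← SetLike.mem_coe, hlin]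
      exact ⟨hbidual x fun g hg => (hxD g hg).ge, hbidual (-x) fun g hg => by simp [hxD g hg]⟩
    have hle : Submodule.span ℝ s ≤ LinearMap.ker f := Submodule.span_le.2 hf
    exact hle hxs
  obtain ⟨b, hbD, hbspan, hbli⟩ := exists_linearIndependent ℝ D
  have : Finite b := hbli.finite
  have : Fintype b := Fintype.ofFinite b
  let B := Module.Basis.span hbli
  have hBspan : Submodule.span ℝ (Set.range ((↑) : b → Module.Dual ℝ (Fin n → ℝ))) =
      Submodule.span ℝ D := by rw [Subtype.range_coe, hbspan]
  have hdense := dense_coord_rationalDual B fun f hf => by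
    rw [hBspan] at hf ⊢
    refine Submodule.span_mono ?_ (mem_span_rationalDual hs (hvanish f hf))
    exact fun g hg => ⟨hg.1, hmem g hg.2⟩
  have hopen : IsOpen {c : b → ℝ | ∀ i, 0 < c i} := by
    simp only [Set.ofPred_forall]
    exact isOpen_iInter_of_finite fun i => isOpen_lt continuous_const (continuous_apply i)
  obtain ⟨c, hc, hpos⟩ := hdense.exists_mem_open hopen ⟨fun _ => 1, fun _ => one_pos⟩
  have hsum : (B.equivFun.symm c : Module.Dual ℝ (Fin n → ℝ)) =
      ∑ i, c i • (i : Module.Dual ℝ _) := by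
    rw [Module.Basis.equivFun_symm_apply, Submodule.coe_sum]
    exact Finset.sum_congr rfl fun i _ => by
      rw [Submodule.coe_smul, Module.Basis.span_apply]
  refine ⟨B.equivFun.symm c, fun h0 => ?_, hc, fun x hx => ?_⟩
  · have hc0 : c = 0 := B.equivFun.symm.map_eq_zero_iff.1 (Subtype.ext h0)
    refine hne (Set.eq_univ_of_forall fun x => hbidual x fun f hf => ?_)
    have : IsEmpty b := ⟨fun i => (hpos i).ne' (congrFun hc0 i)⟩
    have hf' : f ∈ Submodule.span ℝ D := Submodule.subset_span hf
    rw [← hBspan, Set.range_eq_empty, Submodule.span_empty, Submodule.mem_bot] at hf'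
    simp [hf']
  · rw [hsum, LinearMap.sum_apply]
    exact Finset.sum_nonneg fun i _ => mul_nonneg (hpos i).le (hbD i.2 x hx)
end

section
/- Let U, V be finite-dimensional real vector spaces, let σ ⊆ U be a convex cone that decomposes as σ = L + σ′ where L = lin σ = σ ∩ (−σ) is its lineality space and σ′ ⊆ U is a convex cone, and let τ ⊆ V be a convex cone. Then σ ⊗ τ = W + σ′ ⊗ τ, where σ ⊗ τ and σ′ ⊗ τ denote the conical convex hulls in U ⊗ V of the sets {u ⊗ v : u ∈ σ, v ∈ τ} and {u ⊗ v : u ∈ σ′, v ∈ τ} respectively, and W ⊆ U ⊗ V is the linear subspace spanned by {w ⊗ v : w ∈ L, v ∈ span(τ)}. -/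
open Pointwise TensorProduct

/-- The conical convex hull of a set: all finite nonnegative linear combinations
of elements of the set. -/
def conicalHull {V : Type*} [AddCommGroup V] [Module ℝ V] (X : Set V) : Set V :=
  {x | ∃ (k : ℕ) (t : Fin k → ℝ) (v : Fin k → V),
    (∀ i, 0 ≤ t i) ∧ (∀ i, v i ∈ X) ∧ x = ∑ i, t i • v i}

/-- The tensor product of cones: the conical convex hull of elementary tensors of
elements of the cones. -/
def coneTensor {U V : Type*} [AddCommGroup U] [Module ℝ U] [AddCommGroup V] [Module ℝ V]
    (σ : Set U) (τ : Set V) : Set (U ⊗[ℝ] V) :=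
  conicalHull {w | ∃ u ∈ σ, ∃ v ∈ τ, w = u ⊗ₜ[ℝ] v}

theorem IsConvexCone.sum_mem {V ι : Type*} [AddCommGroup V] [Module ℝ V] {σ : Set V}
    (hσ : IsConvexCone σ) (s : Finset ι) {f : ι → V} (hf : ∀ i ∈ s, f i ∈ σ) :
    ∑ i ∈ s, f i ∈ σ :=
  Finset.sum_induction f (· ∈ σ) (fun x y hx hy => hσ.2.1 x hx y hy) hσ.1 hf

theorem IsConvexCone.add {V : Type*} [AddCommGroup V] [Module ℝ V] {σ τ : Set V}
    (hσ : IsConvexCone σ) (hτ : IsConvexCone τ) : IsConvexCone (σ + τ) := by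
  refine ⟨⟨0, hσ.1, 0, hτ.1, add_zero 0⟩, ?_, ?_⟩
  · rintro _ ⟨a, ha, b, hb, rfl⟩ _ ⟨c, hc, d, hd, rfl⟩
    exact ⟨a + c, hσ.2.1 a ha c hc, b + d, hτ.2.1 b hb d hd, add_add_add_comm a c b d⟩
  · rintro r hr _ ⟨a, ha, b, hb, rfl⟩
    exact ⟨r • a, hσ.2.2 r hr a ha, r • b, hτ.2.2 r hr b hb, (smul_add r a b).symm⟩

theorem Submodule.isConvexCone {V : Type*} [AddCommGroup V] [Module ℝ V]
    (W : Submodule ℝ V) : IsConvexCone (W : Set V) :=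
  ⟨W.zero_mem, fun _ hx _ hy => W.add_mem hx hy, fun c _ _ hx => W.smul_mem c hx⟩

theorem isConvexCone_conicalHull {V : Type*} [AddCommGroup V] [Module ℝ V] (X : Set V) :
    IsConvexCone (conicalHull X) := by
  refine ⟨⟨0, Fin.elim0, Fin.elim0, fun i => i.elim0, fun i => i.elim0, by simp⟩, ?_, ?_⟩
  · rintro _ ⟨k, t, v, ht, hv, rfl⟩ _ ⟨l, s, w, hs, hw, rfl⟩
    refine ⟨k + l, Fin.append t s, Fin.append v w, fun i => ?_, fun i => ?_, ?_⟩
    · refine Fin.addCases (fun i => ?_) (fun i => ?_) i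
      · simpa using ht i
      · simpa using hs i
    · refine Fin.addCases (fun i => ?_) (fun i => ?_) i
      · simpa using hv i
      · simpa using hw i
    · simp [Fin.sum_univ_add]
  · rintro c hc _ ⟨k, t, v, ht, hv, rfl⟩
    exact ⟨k, fun i => c * t i, v, fun i => mul_nonneg hc (ht i), hv,
      by simp [Finset.smul_sum, mul_smul]⟩

theorem subset_conicalHull {V : Type*} [AddCommGroup V] [Module ℝ V] (X : Set V) :
    X ⊆ conicalHull X :=
  fun x hx => ⟨1, fun _ => 1, fun _ => x, fun _ => zero_le_one, fun _ => hx, by simp⟩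

theorem conicalHull_subset {V : Type*} [AddCommGroup V] [Module ℝ V] {X σ : Set V}
    (hσ : IsConvexCone σ) (hX : X ⊆ σ) : conicalHull X ⊆ σ := by
  rintro _ ⟨k, t, v, ht, hv, rfl⟩
  exact hσ.sum_mem _ fun i _ => hσ.2.2 (t i) (ht i) (v i) (hX (hv i))

theorem conicalHull_mono {V : Type*} [AddCommGroup V] [Module ℝ V] {X Y : Set V}
    (h : X ⊆ Y) : conicalHull X ⊆ conicalHull Y :=
  conicalHull_subset (isConvexCone_conicalHull Y) (h.trans (subset_conicalHull Y))

theorem tmul_mem_coneTensor {U V : Type*} [AddCommGroup U] [Module ℝ U] [AddCommGroup V]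
    [Module ℝ V] {σ : Set U} {τ : Set V} {u : U} {v : V} (hu : u ∈ σ) (hv : v ∈ τ) :
    u ⊗ₜ[ℝ] v ∈ coneTensor σ τ :=
  subset_conicalHull _ ⟨u, hu, v, hv, rfl⟩

/-- The lineality space of a convex cone is closed under all real scalars. -/
theorem IsConvexCone.smul_mem_lineality {V : Type*} [AddCommGroup V] [Module ℝ V] {σ : Set V}
    (hσ : IsConvexCone σ) (c : ℝ) {x : V} (hx : x ∈ σ ∩ (-σ)) : c • x ∈ σ ∩ (-σ) := by
  obtain ⟨h₁, h₂⟩ := hx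
  rw [Set.mem_neg] at h₂
  rcases le_total 0 c with hc | hc
  · exact ⟨hσ.2.2 c hc x h₁, by simpa using hσ.2.2 c hc (-x) h₂⟩
  · have hc' : 0 ≤ -c := neg_nonneg.2 hc
    exact ⟨by simpa using hσ.2.2 (-c) hc' (-x) h₂, by simpa using hσ.2.2 (-c) hc' x h₁⟩

theorem tmul_mem_coneTensor_of_mem_lineality {U V : Type*} [AddCommGroup U] [Module ℝ U]
    [AddCommGroup V] [Module ℝ V] {σ : Set U} {τ : Set V} (hσ : IsConvexCone σ) {v : V}
    (hv : v ∈ Submodule.span ℝ τ) : ∀ a ∈ σ ∩ (-σ), a ⊗ₜ[ℝ] v ∈ coneTensor σ τ := by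
  have hC : IsConvexCone (coneTensor σ τ) := isConvexCone_conicalHull _
  induction hv using Submodule.span_induction with
  | mem v hv => exact fun a ha => tmul_mem_coneTensor ha.1 hv
  | zero => exact fun a _ => by simpa using hC.1
  | add v w _ _ hv hw =>
    intro a ha
    rw [TensorProduct.tmul_add]
    exact hC.2.1 _ (hv a ha) _ (hw a ha)
  | smul c v _ hv =>
    intro a ha
    rw [← TensorProduct.smul_tmul]
    exact hv _ (hσ.smul_mem_lineality c ha)

theorem span_lineality_subset_coneTensor {U V : Type*} [AddCommGroup U] [Module ℝ U]
    [AddCommGroup V] [Module ℝ V] {σ : Set U} {τ : Set V} (hσ : IsConvexCone σ) :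
    (Submodule.span ℝ
      {w : U ⊗[ℝ] V | ∃ a ∈ σ ∩ (-σ), ∃ v ∈ Submodule.span ℝ τ, w = a ⊗ₜ[ℝ] v} :
        Set (U ⊗[ℝ] V)) ⊆ coneTensor σ τ := by
  have hC : IsConvexCone (coneTensor σ τ) := isConvexCone_conicalHull _
  intro w hw
  suffices h : ∀ c : ℝ, c • w ∈ coneTensor σ τ by simpa using h 1
  induction hw using Submodule.span_induction with
  | mem w hw =>
    obtain ⟨a, ha, v, hv, rfl⟩ := hw
    intro c
    rw [TensorProduct.smul_tmul']
    exact tmul_mem_coneTensor_of_mem_lineality hσ hv _ (hσ.smul_mem_lineality c ha)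
  | zero => simpa using hC.1
  | add x y _ _ hx hy =>
    intro c
    rw [smul_add]
    exact hC.2.1 _ (hx c) _ (hy c)
  | smul d x _ hx =>
    intro c
    rw [smul_smul]
    exact hx (c * d)

/-- If σ = lin σ + σ' then σ ⊗ τ = (lin σ ⊗ span τ) + σ' ⊗ τ. -/
theorem stmt3 {U V : Type*} [AddCommGroup U] [Module ℝ U] [FiniteDimensional ℝ U]
    [AddCommGroup V] [Module ℝ V] [FiniteDimensional ℝ V]
    (σ σ' : Set U) (τ : Set V) (hσ : IsConvexCone σ) (hσ' : IsConvexCone σ')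
    (hτ : IsConvexCone τ) (hdec : σ = (σ ∩ (-σ)) + σ') :
    coneTensor σ τ =
      (Submodule.span ℝ
        {w : U ⊗[ℝ] V | ∃ a ∈ σ ∩ (-σ), ∃ v ∈ Submodule.span ℝ τ, w = a ⊗ₜ[ℝ] v} :
          Set (U ⊗[ℝ] V)) + coneTensor σ' τ := by
  have hC : IsConvexCone (coneTensor σ τ) := isConvexCone_conicalHull _
  apply Set.Subset.antisymm
  · refine conicalHull_subset ((Submodule.isConvexCone _).add (isConvexCone_conicalHull _)) ?_
    rintro _ ⟨u, hu, v, hv, rfl⟩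
    rw [hdec] at hu
    obtain ⟨a, ha, b, hb, rfl⟩ := hu
    exact ⟨a ⊗ₜ v, Submodule.subset_span ⟨a, ha, v, Submodule.subset_span hv, rfl⟩,
      b ⊗ₜ v, tmul_mem_coneTensor hb hv, (TensorProduct.add_tmul a b v).symm⟩
  · have hsub : σ' ⊆ σ := by
      intro x hx
      rw [hdec]
      exact ⟨0, ⟨hσ.1, by simpa using hσ.1⟩, x, hx, zero_add x⟩
    rintro _ ⟨w, hw, x, hx, rfl⟩
    refine hC.2.1 w (span_lineality_subset_coneTensor hσ hw) x (conicalHull_mono ?_ hx)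
    rintro _ ⟨u, hu, v, hv, rfl⟩
    exact ⟨u, hsub hu, v, hv, rfl⟩
end

section
/- Let σ ⊆ U and τ ⊆ V be convex cones in finite-dimensional real vector spaces. Then the lineality space of their tensor product satisfies lin(σ ⊗ τ) = lin(σ) ⊗ span(τ) + span(σ) ⊗ lin(τ), where for linear subspaces W ⊆ U and Z ⊆ V the notation W ⊗ Z denotes the linear subspace of U ⊗ V spanned by {w ⊗ z : w ∈ W, z ∈ Z}. In particular, the tensor product of two salient convex cones is salient. -/
open Pointwise TensorProduct

theorem IsConvexCone.convex {V : Type*} [AddCommGroup V] [Module ℝ V] {σ : Set V}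
    (hσ : IsConvexCone σ) : Convex ℝ σ :=
  fun _ hx _ hy _ _ ha hb _ ↦ hσ.2.1 _ (hσ.2.2 _ ha _ hx) _ (hσ.2.2 _ hb _ hy)

/-- The lineality space of a convex cone, as a submodule. -/
def IsConvexCone.lineality {V : Type*} [AddCommGroup V] [Module ℝ V] {σ : Set V}
    (hσ : IsConvexCone σ) : Submodule ℝ V where
  carrier := σ ∩ -σ
  zero_mem' := ⟨hσ.1, by simpa using hσ.1⟩
  add_mem' := by
    rintro x y ⟨hx, hx'⟩ ⟨hy, hy'⟩
    refine ⟨hσ.2.1 _ hx _ hy, ?_⟩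
    simpa only [Set.mem_neg, neg_add] using hσ.2.1 _ hx' _ hy'
  smul_mem' := by
    rintro c x ⟨hx, hx'⟩
    rcases le_total 0 c with hc | hc
    · exact ⟨hσ.2.2 c hc x hx, by simpa using hσ.2.2 c hc _ hx'⟩
    · exact ⟨by simpa using hσ.2.2 (-c) (neg_nonneg.2 hc) _ hx',
        by simpa using hσ.2.2 (-c) (neg_nonneg.2 hc) _ hx⟩

theorem IsConvexCone.convex_diff_lineality {V : Type*} [AddCommGroup V] [Module ℝ V] {σ : Set V}
    (hσ : IsConvexCone σ) : Convex ℝ (σ \ hσ.lineality) := by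
  have key : ∀ x ∈ σ, ∀ y ∈ σ, x + y ∈ hσ.lineality → x ∈ hσ.lineality := by
    intro x hx y hy hxy
    refine ⟨hx, ?_⟩
    have h := hσ.2.1 _ hy _ hxy.2
    rwa [show y + -(x + y) = -x by abel] at h
  rintro x ⟨hx, hx'⟩ y ⟨hy, hy'⟩ a b ha hb hab
  refine ⟨hσ.convex hx hy ha hb hab, fun h ↦ ?_⟩
  rcases ha.eq_or_lt with rfl | ha'
  · obtain rfl : b = 1 := by simpa using hab
    exact hy' (by simpa using h)
  · have h' := key _ (hσ.2.2 a ha x hx) _ (hσ.2.2 b hb y hy) h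
    exact hx' ((Submodule.smul_mem_iff _ ha'.ne').1 h')

/-- Given finitely many points of a convex cone, some linear functional is nonnegative on them and
vanishes only at those in the lineality space. -/
theorem IsConvexCone.exists_functional {U : Type*} [AddCommGroup U] [Module ℝ U]
    [FiniteDimensional ℝ U] {σ : Set U} (hσ : IsConvexCone σ) {s : Set U} (hs : s.Finite)
    (hsσ : s ⊆ σ) :
    ∃ f : U →ₗ[ℝ] ℝ, ∀ x ∈ s, 0 ≤ f x ∧ (f x = 0 → x ∈ hσ.lineality) := by
  let e := (Module.finBasis ℝ (U ⧸ hσ.lineality)).equivFun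
  let L := e.toLinearMap ∘ₗ hσ.lineality.mkQ
  have hL : ∀ x, L x = 0 ↔ x ∈ hσ.lineality := by simp [L]
  have hfin : (L '' (s \ hσ.lineality)).Finite := (hs.subset Set.sdiff_subset).image L
  have h0 : 0 ∉ convexHull ℝ (L '' (s \ hσ.lineality)) := by
    rw [← L.image_convexHull]
    rintro ⟨x, hx, hx0⟩
    exact (convexHull_min (Set.sdiff_subset_sdiff_left hsσ) hσ.convex_diff_lineality hx).2
      ((hL x).1 hx0)
  obtain ⟨f, c, hf0, hf⟩ := geometric_hahn_banach_point_closed (convex_convexHull ℝ _)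
    (hfin.isCompact_convexHull ℝ).isClosed h0
  rw [map_zero] at hf0
  refine ⟨f.toLinearMap ∘ₗ L, fun x hx ↦ ?_⟩
  by_cases hxl : x ∈ hσ.lineality
  · simp [(hL x).2 hxl, hxl]
  · have hpos : 0 < f (L x) :=
      hf0.trans (hf _ (subset_convexHull ℝ _ (Set.mem_image_of_mem L ⟨hx, hxl⟩)))
    exact ⟨hpos.le, fun h ↦ absurd h hpos.ne'⟩

/-- If a nonnegative combination of elementary tensors from two convex cones vanishes, then each
term with positive coefficient has a factor in the lineality space of its cone. -/
theorem mem_lineality_or_of_sum_tmul_eq_zero {U V ι : Type*} [AddCommGroup U] [Module ℝ U]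
    [FiniteDimensional ℝ U] [AddCommGroup V] [Module ℝ V] [FiniteDimensional ℝ V] [Fintype ι]
    {σ : Set U} {τ : Set V} (hσ : IsConvexCone σ) (hτ : IsConvexCone τ)
    {t : ι → ℝ} {u : ι → U} {v : ι → V} (ht : ∀ i, 0 ≤ t i) (hu : ∀ i, u i ∈ σ)
    (hv : ∀ i, v i ∈ τ) (h : ∑ i, t i • u i ⊗ₜ[ℝ] v i = 0) (i : ι) :
    t i = 0 ∨ u i ∈ hσ.lineality ∨ v i ∈ hτ.lineality := by
  obtain ⟨f, hf⟩ := hσ.exists_functional (Set.finite_range u) (Set.range_subset_iff.2 hu)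
  obtain ⟨g, hg⟩ := hτ.exists_functional (Set.finite_range v) (Set.range_subset_iff.2 hv)
  rw [Set.forall_mem_range] at hf hg
  have hsum : ∑ i, t i * (f (u i) * g (v i)) = 0 := by
    simpa using congrArg (LinearMap.mul' ℝ ℝ ∘ₗ TensorProduct.map f g) h
  have hi := (Finset.sum_eq_zero_iff_of_nonneg fun i _ ↦
    mul_nonneg (ht i) (mul_nonneg (hf i).1 (hg i).1)).1 hsum i (Finset.mem_univ i)
  rcases mul_eq_zero.1 hi with hi | hi
  · exact Or.inl hi
  · exact Or.inr ((mul_eq_zero.1 hi).imp (hf i).2 (hg i).2)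

/-- lin(σ ⊗ τ) = (lin σ) ⊗ span τ + span σ ⊗ (lin τ); in particular, the tensor
product of two salient convex cones is salient. -/
theorem stmt4 {U V : Type*} [AddCommGroup U] [Module ℝ U] [FiniteDimensional ℝ U]
    [AddCommGroup V] [Module ℝ V] [FiniteDimensional ℝ V]
    (σ : Set U) (τ : Set V) (hσ : IsConvexCone σ) (hτ : IsConvexCone τ) :
    (coneTensor σ τ ∩ (-(coneTensor σ τ)) =
      ↑(Submodule.span ℝ
          {w : U ⊗[ℝ] V | ∃ u ∈ σ ∩ (-σ), ∃ v ∈ Submodule.span ℝ τ, w = u ⊗ₜ[ℝ] v} ⊔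
        Submodule.span ℝ
          {w : U ⊗[ℝ] V | ∃ u ∈ Submodule.span ℝ σ, ∃ v ∈ τ ∩ (-τ), w = u ⊗ₜ[ℝ] v})) ∧
    (σ ∩ (-σ) = {0} → τ ∩ (-τ) = {0} →
      coneTensor σ τ ∩ (-(coneTensor σ τ)) = {0}) := by
  have main : coneTensor σ τ ∩ (-(coneTensor σ τ)) =
      ↑(Submodule.span ℝ
          {w : U ⊗[ℝ] V | ∃ u ∈ σ ∩ (-σ), ∃ v ∈ Submodule.span ℝ τ, w = u ⊗ₜ[ℝ] v} ⊔
        Submodule.span ℝ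
          {w : U ⊗[ℝ] V | ∃ u ∈ Submodule.span ℝ σ, ∃ v ∈ τ ∩ (-τ), w = u ⊗ₜ[ℝ] v}) := by
    apply Set.Subset.antisymm
    · rintro x ⟨⟨k, t, w, ht, hw, hx⟩, l, s, z, hs, hz, hx'⟩
      choose u hu v hv hw using hw
      choose u' hu' v' hv' hz using hz
      have hsum : ∑ i, Sum.elim t s i • (Sum.elim u u' i ⊗ₜ[ℝ] Sum.elim v v' i) = 0 := by
        simp only [Fintype.sum_sum_type, Sum.elim_inl, Sum.elim_inr, ← hw, ← hz]
        rw [← hx, ← hx', add_neg_cancel]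
      have key := mem_lineality_or_of_sum_tmul_eq_zero hσ hτ
        (Sum.forall.2 ⟨ht, hs⟩) (Sum.forall.2 ⟨hu, hu'⟩) (Sum.forall.2 ⟨hv, hv'⟩) hsum
      rw [hx]
      refine Submodule.sum_mem _ fun i _ ↦ ?_
      rw [hw i]
      rcases key (Sum.inl i) with h | h | h
      · rw [Sum.elim_inl] at h
        simp [h]
      · exact Submodule.smul_mem _ _ (Submodule.mem_sup_left
          (Submodule.subset_span ⟨u i, h, v i, Submodule.subset_span (hv i), rfl⟩))
      · exact Submodule.smul_mem _ _ (Submodule.mem_sup_right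
          (Submodule.subset_span ⟨u i, Submodule.subset_span (hu i), v i, h, rfl⟩))
    · have hC : IsConvexCone (coneTensor σ τ) := isConvexCone_conicalHull _
      have hmem : ∀ u ∈ σ, ∀ v ∈ τ, u ⊗ₜ[ℝ] v ∈ coneTensor σ τ :=
        fun u hu v hv ↦ subset_conicalHull _ ⟨u, hu, v, hv, rfl⟩
      change _ ≤ hC.lineality
      refine sup_le (Submodule.span_le.2 ?_) (Submodule.span_le.2 ?_)
      · rintro _ ⟨u, hu, v, hv, rfl⟩
        have hle : Submodule.span ℝ τ ≤ hC.lineality.comap (TensorProduct.mk ℝ U V u) :=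
          Submodule.span_le.2 fun v hv ↦ ⟨hmem _ hu.1 _ hv, by
            simpa [TensorProduct.neg_tmul] using hmem _ hu.2 _ hv⟩
        exact hle hv
      · rintro _ ⟨u, hu, v, hv, rfl⟩
        have hle : Submodule.span ℝ σ ≤ hC.lineality.comap ((TensorProduct.mk ℝ U V).flip v) :=
          Submodule.span_le.2 fun u hu ↦ ⟨hmem _ hu _ hv.1, by
            simpa [TensorProduct.tmul_neg] using hmem _ hu _ hv.2⟩
        exact hle hu
  refine ⟨main, fun h1 h2 ↦ ?_⟩
  rw [main, h1, h2]
  refine congrArg SetLike.coe (eq_bot_iff.2 ?_ : _ = (⊥ : Submodule ℝ (U ⊗[ℝ] V)))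
  refine sup_le (Submodule.span_le.2 ?_) (Submodule.span_le.2 ?_)
  · rintro _ ⟨u, rfl, v, -, rfl⟩
    simp
  · rintro _ ⟨u, -, v, rfl, rfl⟩
    simp
end

section
/- Let n be an odd positive integer and let H : ℝⁿ → ℝ be a linear functional such that H(k, k², …, kⁿ) ≥ 0 for every integer k. Then H vanishes on the n-th standard basis vector: H(0, …, 0, 1) = 0. -/
open Polynomial in
/-- A real polynomial of degree at most `m`, `0 < m`, that is nonnegative at all natural numbers
has nonnegative coefficient in degree `m`. -/
theorem coeff_nonneg_of_forall_eval_natCast_nonneg {p : ℝ[X]} {m : ℕ} (hm : 0 < m)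
    (hdeg : p.natDegree ≤ m) (hp : ∀ k : ℕ, 0 ≤ p.eval (k : ℝ)) : 0 ≤ p.coeff m := by
  by_contra! h
  have hnat : p.natDegree = m := hdeg.antisymm (le_natDegree_of_ne_zero h.ne)
  have hlc : p.leadingCoeff ≤ 0 := by rw [leadingCoeff, hnat]; exact h.le
  have hlim := (p.tendsto_atBot_of_leadingCoeff_nonpos
    (natDegree_pos_iff_degree_pos.mp (hnat ▸ hm)) hlc).comp tendsto_natCast_atTop_atTop
  obtain ⟨k, hk⟩ := (hlim.eventually (Filter.eventually_lt_atBot 0)).exists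
  exact (hp k).not_gt hk

open Polynomial in
/-- A real polynomial of degree at most `m`, `m` odd, that is nonnegative at all integers
has zero coefficient in degree `m`. -/
theorem coeff_eq_zero_of_odd_of_forall_eval_intCast_nonneg {p : ℝ[X]} {m : ℕ} (hm : Odd m)
    (hdeg : p.natDegree ≤ m) (hp : ∀ k : ℤ, 0 ≤ p.eval (k : ℝ)) : p.coeff m = 0 := by
  have h₁ := coeff_nonneg_of_forall_eval_natCast_nonneg hm.pos hdeg
    fun k => by simpa using hp k
  have h₂ := coeff_nonneg_of_forall_eval_natCast_nonneg (p := p.comp (-X)) hm.pos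
    (by simpa [natDegree_comp] using hdeg) fun k => by simpa [eval_comp] using hp (-k)
  rw [show (-X : ℝ[X]) = C (-1) * X by simp, comp_C_mul_X_coeff, hm.neg_one_pow] at h₂
  linarith

/-- If n is odd and a linear functional H on ℝⁿ is nonnegative on all integer
points (k, k², …, kⁿ) of the moment curve, then H vanishes on the n-th standard
basis vector. -/
theorem stmt8 {n : ℕ} (hn : Odd n) (hpos : 0 < n)
    (H : (Fin n → ℝ) →ₗ[ℝ] ℝ)
    (hH : ∀ k : ℤ, 0 ≤ H (fun i => (k : ℝ) ^ ((i : ℕ) + 1))) :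
    H (Pi.single (⟨n - 1, by omega⟩ : Fin n) 1) = 0 := by
  let p : Polynomial ℝ :=
    ∑ i : Fin n, Polynomial.monomial ((i : ℕ) + 1) (H (Pi.single i 1))
  have hdeg : p.natDegree ≤ n := Polynomial.natDegree_sum_le_of_forall_le _ _ fun i _ =>
    (Polynomial.natDegree_monomial_le _).trans i.isLt
  have heval (k : ℤ) : 0 ≤ p.eval (k : ℝ) := by
    have h := hH k
    rw [LinearMap.pi_apply_eq_sum_univ] at h
    have hsingle (i : Fin n) : (fun j => if i = j then (1 : ℝ) else 0) = Pi.single i 1 := by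
      ext j
      simp [Pi.single_apply, eq_comm]
    simpa [p, Polynomial.eval_finsetSum, hsingle, mul_comm] using h
  have hcoeff : p.coeff n = H (Pi.single (⟨n - 1, by omega⟩ : Fin n) 1) := by
    rw [Polynomial.finsetSum_coeff, Finset.sum_eq_single ⟨n - 1, by omega⟩]
    · simp [Nat.sub_add_cancel hpos]
    · intro i _ hi
      refine Polynomial.coeff_monomial_of_ne _ fun h => hi (Fin.ext ?_)
      simp only
      omega
    · simp
  rw [← hcoeff]
  exact coeff_eq_zero_of_odd_of_forall_eval_intCast_nonneg hn hdeg heval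
end

section
/- Let n ≥ 2 and let C ⊆ ℝⁿ be the closure of the convex hull of the set S = {(1/k, 1/k², …, 1/kⁿ) : k ∈ ℤ, k ≠ 0} ∪ {(0, 0, …, 0)}. Then C is a compact convex set and its set of extreme points is exactly S. -/
/-- The join of two compact sets in a real topological vector space is compact. -/
theorem isCompact_convexJoin {E : Type*} [AddCommGroup E] [Module ℝ E] [TopologicalSpace E]
    [ContinuousAdd E] [ContinuousSMul ℝ E] {s t : Set E} (hs : IsCompact s) (ht : IsCompact t) :
    IsCompact (convexJoin ℝ s t) := by
  have himage : convexJoin ℝ s t =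
      (fun p : ℝ × E × E => (1 - p.1) • p.2.1 + p.1 • p.2.2) '' (Set.Icc 0 1 ×ˢ s ×ˢ t) := by
    ext x
    simp only [mem_convexJoin, segment_eq_image, Set.mem_image, Set.mem_prod, Prod.exists]
    constructor
    · rintro ⟨a, ha, b, hb, θ, hθ, h⟩
      exact ⟨θ, a, b, ⟨hθ, ha, hb⟩, h⟩
    · rintro ⟨θ, a, b, ⟨hθ, ha, hb⟩, h⟩
      exact ⟨a, ha, b, hb, θ, hθ, h⟩
  rw [himage]
  exact (isCompact_Icc.prod (hs.prod ht)).image (by fun_prop)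

/-- If a set is covered by a finite subset of itself and a closed convex set, then so are the
extreme points of its closed convex hull. -/
theorem extremePoints_closure_convexHull_subset_union {E : Type*} [NormedAddCommGroup E]
    [NormedSpace ℝ E] {S F D : Set E} (hC : IsCompact (closure (convexHull ℝ S)))
    (hF : F.Finite) (hFne : F.Nonempty) (hFS : F ⊆ S) (hD : IsClosed D) (hDconv : Convex ℝ D)
    (hDne : (S ∩ D).Nonempty) (hS : S ⊆ F ∪ D) :
    (closure (convexHull ℝ S)).extremePoints ℝ ⊆ F ∪ D := by
  set C := closure (convexHull ℝ S) with hCdef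
  have hSC : S ⊆ C := (subset_convexHull ℝ S).trans subset_closure
  have hCconv : Convex ℝ C := (convex_convexHull ℝ S).closure
  have hFC : convexHull ℝ F ⊆ C := (convexHull_mono hFS).trans subset_closure
  have hCDne : (C ∩ D).Nonempty := hDne.mono (Set.inter_subset_inter_left D hSC)
  have hsub : C ⊆ convexJoin ℝ (convexHull ℝ F) (C ∩ D) := by
    refine closure_minimal (convexHull_min ?_ ?_) ?_
    · intro y hy
      rcases hS hy with hyF | hyD
      · exact subset_convexJoin_left hCDne (subset_convexHull ℝ F hyF)
      · exact subset_convexJoin_right hFne.convexHull ⟨hSC hy, hyD⟩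
    · exact (convex_convexHull ℝ F).convexJoin (hCconv.inter hDconv)
    · exact (isCompact_convexJoin (hF.isCompact_convexHull ℝ) (hC.inter_right hD)).isClosed
  intro x hx
  obtain ⟨a, ha, b, hb, hxab⟩ := mem_convexJoin.1 (hsub hx.1)
  rcases (mem_extremePoints_iff_forall_segment.1 hx).2 a (hFC ha) b hb.1 hxab with rfl | rfl
  · exact Or.inl (extremePoints_convexHull_subset
      (inter_extremePoints_subset_extremePoints_of_subset hFC ⟨ha, hx⟩))
  · exact Or.inr hb.2

/-- If a continuous linear functional on a compact set `C` is maximized at `p`, and `p` is the only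
extreme point of `C` at which it takes its maximal value, then `p` is an extreme point. -/
theorem IsCompact.mem_extremePoints_of_forall_le {E : Type*} [AddCommGroup E] [Module ℝ E]
    [TopologicalSpace E] [T2Space E] [IsTopologicalAddGroup E] [ContinuousSMul ℝ E]
    [LocallyConvexSpace ℝ E] {C : Set E} (hC : IsCompact C) (l : StrongDual ℝ E) {p : E}
    (hp : p ∈ C) (hle : ∀ y ∈ C, l y ≤ l p)
    (huniq : ∀ q ∈ C.extremePoints ℝ, l p ≤ l q → q = p) : p ∈ C.extremePoints ℝ := by
  have hexp : IsExposed ℝ C (l.toExposed C) := ContinuousLinearMap.toExposed.isExposed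
  obtain ⟨q, hq⟩ := (hexp.isCompact hC).extremePoints_nonempty ⟨p, hp, hle⟩
  have hqC := hexp.isExtreme.extremePoints_subset_extremePoints hq
  exact huniq q hqC (hq.1.2 p hp) ▸ hqC

/-- The moment curve in `ℝⁿ`. -/
def momentCurve (n : ℕ) (t : ℝ) : Fin n → ℝ := fun i => t ^ ((i : ℕ) + 1)

theorem norm_momentCurve_le (n : ℕ) {t : ℝ} (ht : |t| ≤ 1) : ‖momentCurve n t‖ ≤ |t| := by
  refine (pi_norm_le_iff_of_nonneg (abs_nonneg t)).2 fun i => ?_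
  rw [momentCurve, Real.norm_eq_abs, abs_pow]
  exact pow_le_of_le_one (abs_nonneg t) ht (Nat.succ_ne_zero _)

theorem momentCurve_zero (n : ℕ) : momentCurve n 0 = 0 := by
  ext i
  simp [momentCurve]

theorem abs_one_div_intCast_le_one (k : ℤ) : |1 / (k : ℝ)| ≤ 1 := by
  rcases eq_or_ne k 0 with rfl | hk
  · simp
  · rw [abs_div, abs_one]
    have : (1 : ℝ) ≤ |(k : ℝ)| := by exact_mod_cast Int.one_le_abs hk
    exact div_le_one_of_le₀ this (abs_nonneg _)

/-- The linear functional whose restriction to the moment curve is `t ↦ a² - (t - a)²`. -/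
theorem exists_strongDual_momentCurve {n : ℕ} (hn : 2 ≤ n) (a : ℝ) :
    ∃ l : StrongDual ℝ (Fin n → ℝ), ∀ t, l (momentCurve n t) = a ^ 2 - (t - a) ^ 2 := by
  refine ⟨(2 * a) • ContinuousLinearMap.proj (⟨0, by omega⟩ : Fin n) -
    ContinuousLinearMap.proj (⟨1, by omega⟩ : Fin n), fun t => ?_⟩
  simp [momentCurve]
  ring

/-- For n ≥ 2, the closure C of the convex hull of the moment-curve points at
parameters 1/k (k a nonzero integer) together with the origin is a compact
convex body whose extreme points are exactly these points. -/
theorem stmt9 {n : ℕ} (hn : 2 ≤ n) (S : Set (Fin n → ℝ))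
    (hS : S = {x : Fin n → ℝ |
        ∃ k : ℤ, k ≠ 0 ∧ x = fun i : Fin n => (1 / (k : ℝ)) ^ ((i : ℕ) + 1)} ∪ {0})
    (C : Set (Fin n → ℝ)) (hC : C = closure (convexHull ℝ S)) :
    IsCompact C ∧ Convex ℝ C ∧ Set.extremePoints ℝ C = S := by
  have hrange : S = Set.range fun k : ℤ => momentCurve n (1 / (k : ℝ)) := by
    rw [hS]
    ext x
    constructor
    · rintro (⟨k, -, rfl⟩ | rfl)
      · exact ⟨k, rfl⟩
      · exact ⟨0, by simp [momentCurve_zero]⟩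
    · rintro ⟨k, rfl⟩
      rcases eq_or_ne k 0 with rfl | hk
      · exact Or.inr (by simp [momentCurve_zero])
      · exact Or.inl ⟨k, hk, rfl⟩
  have hSC : S ⊆ C := hC ▸ (subset_convexHull ℝ S).trans subset_closure
  have hle_of_forall (l : StrongDual ℝ (Fin n → ℝ)) (c : ℝ) (h : ∀ y ∈ S, l y ≤ c) :
      ∀ y ∈ C, l y ≤ c := by
    have hsub : C ⊆ {y | l y ≤ c} := hC ▸ closure_minimal
      (convexHull_min h (convex_halfSpace_le l.toLinearMap.isLinear c))
      (isClosed_le l.continuous continuous_const)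
    exact hsub
  have hcompact : IsCompact C := by
    refine (isCompact_closedBall (0 : Fin n → ℝ) 1).of_isClosed_subset (hC ▸ isClosed_closure) ?_
    rw [hC, hrange]
    refine closure_minimal (convexHull_min ?_ (convex_closedBall _ _)) Metric.isClosed_closedBall
    rintro _ ⟨k, rfl⟩
    rw [mem_closedBall_zero_iff]
    exact (norm_momentCurve_le n (abs_one_div_intCast_le_one k)).trans
      (abs_one_div_intCast_le_one k)
  have hext : C.extremePoints ℝ ⊆ S := by
    intro x hx
    by_cases hx0 : x = 0
    · rw [hS, hx0]
      exact Or.inr rfl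
    have hxpos : 0 < ‖x‖ := norm_pos_iff.2 hx0
    obtain ⟨N, hN⟩ := exists_nat_gt (2 / ‖x‖)
    have hFS : (fun k : ℤ => momentCurve n (1 / (k : ℝ))) '' Set.Icc (-(N : ℤ)) N ⊆ S :=
      hrange ▸ Set.image_subset_range _ _
    have hmem := extremePoints_closure_convexHull_subset_union (hC ▸ hcompact)
      ((Set.finite_Icc (-(N : ℤ)) N).image _)
      (Set.Nonempty.image _ ⟨0, by simp⟩) hFS
      (Metric.isClosed_closedBall (x := (0 : Fin n → ℝ)) (ε := ‖x‖ / 2)) (convex_closedBall _ _)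
      ⟨0, hS ▸ Or.inr rfl, Metric.mem_closedBall_self (by positivity)⟩ ?_ (hC ▸ hx)
    · rcases hmem with h | h
      · exact hFS h
      · rw [mem_closedBall_zero_iff] at h
        linarith
    · rw [hrange]
      rintro _ ⟨k, rfl⟩
      by_cases hk : |k| ≤ (N : ℤ)
      · exact Or.inl ⟨k, abs_le.1 hk, rfl⟩
      · refine Or.inr (mem_closedBall_zero_iff.2 ?_)
        refine (norm_momentCurve_le n (abs_one_div_intCast_le_one k)).trans ?_
        have hNk : (N : ℝ) < |(k : ℝ)| := by exact_mod_cast not_le.1 hk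
        rw [abs_div, abs_one, ← one_div_div 2]
        exact one_div_le_one_div_of_le (by positivity) (hN.trans hNk).le
  refine ⟨hcompact, hC ▸ (convex_convexHull ℝ S).closure, hext.antisymm fun p hp => ?_⟩
  obtain ⟨k, rfl⟩ : p ∈ Set.range fun k : ℤ => momentCurve n (1 / (k : ℝ)) := hrange ▸ hp
  obtain ⟨l, hl⟩ := exists_strongDual_momentCurve hn (1 / (k : ℝ))
  refine hcompact.mem_extremePoints_of_forall_le l (hSC hp) (hle_of_forall l _ ?_) ?_
  · rw [hrange]
    rintro _ ⟨m, rfl⟩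
    simp only [hl]
    nlinarith [sq_nonneg (1 / (m : ℝ) - 1 / (k : ℝ))]
  · intro q hq hle
    obtain ⟨m, rfl⟩ : q ∈ Set.range fun k : ℤ => momentCurve n (1 / (k : ℝ)) := hrange ▸ hext hq
    simp only [hl] at hle
    have hsq : (1 / (m : ℝ) - 1 / (k : ℝ)) ^ 2 = 0 :=
      le_antisymm (by linarith) (sq_nonneg _)
    exact congrArg (momentCurve n) (sub_eq_zero.1 (pow_eq_zero_iff two_ne_zero |>.1 hsq))
end
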